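/- arXiv:2006.04451 — 3 statements merged into one kernel-verified Lean document; each statement's English description precedes it below -/
import Mathlib

section
/- Let A, B : Fin 2 → Fin 2304 → ℝ. For each side s : Fin 2, define A₄ s : Fin 256 → ℝ by A₄ s i = (∑_{j : Fin 9} A s (9·i + j))/9, and for k = 3, 2, 1, 0 define A_k s : Fin 4^k → ℝ by A_k s i = (∑_{j : Fin 4} A_{k+1} s (4·i + j))/4; define B_k analogously. Let r_A = (A₀ 0 0 + A₀ 1 0)/2 and r_B analogously. Then the following chain of inequalities holds: 2·4⁴·9·(r_A − r_B)² ≤ 4⁴·9·∑_s (A₀ s 0 − B₀ s 0)² ≤ 4³·9·∑_s ∑_{i : Fin 4} (A₁ s i − B₁ s i)² ≤ 4²·9·∑_s ∑_{i : Fin 16} (A₂ s i − B₂ s i)² ≤ 4·9·∑_s ∑_{i : Fin 64} (A₃ s i − B₃ s i)² ≤ 9·∑_s ∑_{i : Fin 256} (A₄ s i − B₄ s i)² ≤ ∑_s ∑_{i : Fin 2304} (A s i − B s i)². -/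
/-- Level 4 of a sub-pyramid over a 48×48 base: average of each 3×3 block. -/
noncomputable def level4 (A : Fin 2304 → ℝ) : Fin 256 → ℝ :=
  fun i => (∑ j : Fin 9, A ⟨9 * i.val + j.val, by omega⟩) / 9

/-- Level 3: average of each 2×2 block of level 4. -/
noncomputable def level3 (A : Fin 2304 → ℝ) : Fin 64 → ℝ :=
  fun i => (∑ j : Fin 4, level4 A ⟨4 * i.val + j.val, by omega⟩) / 4

/-- Level 2: average of each 2×2 block of level 3. -/
noncomputable def level2 (A : Fin 2304 → ℝ) : Fin 16 → ℝ :=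
  fun i => (∑ j : Fin 4, level3 A ⟨4 * i.val + j.val, by omega⟩) / 4

/-- Level 1: average of each 2×2 block of level 2. -/
noncomputable def level1 (A : Fin 2304 → ℝ) : Fin 4 → ℝ :=
  fun i => (∑ j : Fin 4, level2 A ⟨4 * i.val + j.val, by omega⟩) / 4

/-- Level 0 (sub-pyramid root): average of each 2×2 block of level 1. -/
noncomputable def level0 (A : Fin 2304 → ℝ) : Fin 1 → ℝ :=
  fun i => (∑ j : Fin 4, level1 A ⟨4 * i.val + j.val, by omega⟩) / 4

/-- Averaging over blocks of length `n` contracts the squared distance by a factor `n`. -/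
theorem block_avg_le {m n N : ℕ} (c : ℝ) (hc : (n : ℝ) = c) (hpos : 0 < c) (hN : m * n = N)
    (hlt : ∀ (i : Fin m) (j : Fin n), n * i.val + j.val < N) (X Y : Fin N → ℝ) :
    c * ∑ i : Fin m, ((∑ j : Fin n, X ⟨n * i.val + j.val, hlt i j⟩) / c
        - (∑ j : Fin n, Y ⟨n * i.val + j.val, hlt i j⟩) / c) ^ 2
      ≤ ∑ i : Fin N, (X i - Y i) ^ 2 := by
  subst hN
  rw [← Equiv.sum_comp finProdFinEquiv, Fintype.sum_prod_type, Finset.mul_sum]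
  apply Finset.sum_le_sum
  intro i _
  have hidx : ∀ j : Fin n, finProdFinEquiv (i, j) = ⟨n * i.val + j.val, hlt i j⟩ := by
    intro j
    ext
    simp [finProdFinEquiv, add_comm]
  simp only [hidx]
  have h := sq_sum_le_card_mul_sum_sq (s := (Finset.univ : Finset (Fin n)))
    (f := fun j => X ⟨n * i.val + j.val, hlt i j⟩ - Y ⟨n * i.val + j.val, hlt i j⟩)
  rw [Finset.card_univ, Fintype.card_fin, hc] at h
  rw [← sub_div, ← Finset.sum_sub_distrib, div_pow, ← mul_div_assoc, div_le_iff₀ (by positivity)]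
  nlinarith [mul_le_mul_of_nonneg_left h hpos.le]

/-- Theorem 1 (Eq. (1)) of the paper: the hybrid-pyramid inequality chain for the
9th-13th convolutional layers of VGG-16, where `A s`, `B s` are the 48×48 bases of the
left (`s = 0`) and right (`s = 1`) sub-pyramids of the two filters' hybrid pyramids. -/
theorem theorem1_vgg_layers9to13 (A B : Fin 2 → Fin 2304 → ℝ) :
    2 * 4 ^ 4 * 9 *
          ((level0 (A 0) 0 + level0 (A 1) 0) / 2 - (level0 (B 0) 0 + level0 (B 1) 0) / 2) ^ 2 ≤
        4 ^ 4 * 9 * ∑ s : Fin 2, (level0 (A s) 0 - level0 (B s) 0) ^ 2 ∧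
      4 ^ 4 * 9 * ∑ s : Fin 2, (level0 (A s) 0 - level0 (B s) 0) ^ 2 ≤
        4 ^ 3 * 9 * ∑ s : Fin 2, ∑ i : Fin 4, (level1 (A s) i - level1 (B s) i) ^ 2 ∧
      4 ^ 3 * 9 * ∑ s : Fin 2, ∑ i : Fin 4, (level1 (A s) i - level1 (B s) i) ^ 2 ≤
        4 ^ 2 * 9 * ∑ s : Fin 2, ∑ i : Fin 16, (level2 (A s) i - level2 (B s) i) ^ 2 ∧
      4 ^ 2 * 9 * ∑ s : Fin 2, ∑ i : Fin 16, (level2 (A s) i - level2 (B s) i) ^ 2 ≤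
        4 * 9 * ∑ s : Fin 2, ∑ i : Fin 64, (level3 (A s) i - level3 (B s) i) ^ 2 ∧
      4 * 9 * ∑ s : Fin 2, ∑ i : Fin 64, (level3 (A s) i - level3 (B s) i) ^ 2 ≤
        9 * ∑ s : Fin 2, ∑ i : Fin 256, (level4 (A s) i - level4 (B s) i) ^ 2 ∧
      9 * ∑ s : Fin 2, ∑ i : Fin 256, (level4 (A s) i - level4 (B s) i) ^ 2 ≤
        ∑ s : Fin 2, ∑ i : Fin 2304, (A s i - B s i) ^ 2 := by
  have key : ∀ s, 
      4 * (level0 (A s) 0 - level0 (B s) 0) ^ 2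
        ≤ ∑ i : Fin 4, (level1 (A s) i - level1 (B s) i) ^ 2 := by
    intro s
    have h := block_avg_le (m := 1) (n := 4) 4 (by norm_num) (by norm_num) rfl
      (fun i j => by omega) (level1 (A s)) (level1 (B s))
    rw [Fin.sum_univ_one] at h
    exact h
  have key1 : ∀ s, _ := fun s => block_avg_le (m := 4) (n := 4) 4 (by norm_num) (by norm_num) rfl
      (fun i j => by omega) (level2 (A s)) (level2 (B s))
  have key2 : ∀ s, _ := fun s => block_avg_le (m := 16) (n := 4) 4 (by norm_num) (by norm_num) rfl
      (fun i j => by omega) (level3 (A s)) (level3 (B s))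
  have key3 : ∀ s, _ := fun s => block_avg_le (m := 64) (n := 4) 4 (by norm_num) (by norm_num) rfl
      (fun i j => by omega) (level4 (A s)) (level4 (B s))
  have key4 : ∀ s, _ := fun s => block_avg_le (m := 256) (n := 9) 9 (by norm_num) (by norm_num) rfl
      (fun i j => by omega) (A s) (B s)
  change ∀ s, 4 * ∑ i : Fin 4, (level1 (A s) i - level1 (B s) i) ^ 2 ≤ _ at key1
  change ∀ s, 4 * ∑ i : Fin 16, (level2 (A s) i - level2 (B s) i) ^ 2 ≤ _ at key2
  change ∀ s, 4 * ∑ i : Fin 64, (level3 (A s) i - level3 (B s) i) ^ 2 ≤ _ at key3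
  change ∀ s, 9 * ∑ i : Fin 256, (level4 (A s) i - level4 (B s) i) ^ 2 ≤ _ at key4
  simp only [Fin.sum_univ_two]
  refine ⟨?_, ?_, ?_, ?_, ?_, ?_⟩
  · nlinarith [sq_nonneg ((level0 (A 0) 0 - level0 (B 0) 0) - (level0 (A 1) 0 - level0 (B 1) 0))]
  · linarith only [key 0, key 1]
  · linarith only [key1 0, key1 1]
  · linarith only [key2 0, key2 1]
  · linarith only [key3 0, key3 1]
  · linarith only [key4 0, key4 1]
end

section
/- Let A, B : Fin 4608 → ℝ, let r_A = (∑_i A i)/4608 and r_B = (∑_i B i)/4608, and let d : ℝ with d ≥ 0. If ∑_{i} (A i − B i)² ≤ d², then |r_A − r_B| ≤ d/(√2·4²·3). -/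
theorem candidate_elimination_rule (A B : Fin 4608 → ℝ) (d : ℝ) (hd : 0 ≤ d)
    (h : ∑ i : Fin 4608, (A i - B i) ^ 2 ≤ d ^ 2) :
    |(∑ i, A i) / 4608 - (∑ i, B i) / 4608| ≤ d / (Real.sqrt 2 * 4 ^ 2 * 3) := by
  have hc : (∑ i : Fin 4608, (A i - B i)) ^ 2 ≤ 4608 * ∑ i : Fin 4608, (A i - B i) ^ 2 := by
    have := sq_sum_le_card_mul_sum_sq (s := (Finset.univ : Finset (Fin 4608)))
      (f := fun i => A i - B i)
    rw [Finset.card_univ, Fintype.card_fin] at this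
    exact_mod_cast this
  rw [Finset.sum_sub_distrib] at hc
  have hs : Real.sqrt 2 ^ 2 = 2 := Real.sq_sqrt (by norm_num)
  apply abs_le_of_sq_le_sq _ (by positivity)
  have e : (d / (Real.sqrt 2 * 4 ^ 2 * 3)) ^ 2 = d ^ 2 / 4608 := by
    rw [div_pow, mul_pow, mul_pow, hs]; norm_num
  rw [e, ← sub_div, div_pow, div_le_div_iff₀ (by norm_num) (by norm_num)]
  linarith
end

section
/- Let A, B, C : Fin 4608 → ℝ, and let r_A = (∑_i A i)/4608 and r_B = (∑_i B i)/4608. If ∑_{i} (A i − C i)² < 2·4⁴·9·(r_A − r_B)², then ∑_{i} (A i − C i)² < ∑_{i} (A i − B i)². -/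
theorem distance_computation_pruning (A B C : Fin 4608 → ℝ)
    (h : ∑ i : Fin 4608, (A i - C i) ^ 2 <
      2 * 4 ^ 4 * 9 * ((∑ i, A i) / 4608 - (∑ i, B i) / 4608) ^ 2) :
    ∑ i : Fin 4608, (A i - C i) ^ 2 < ∑ i : Fin 4608, (A i - B i) ^ 2 := by
  refine lt_of_lt_of_le h ?_
  have key := sq_sum_le_card_mul_sum_sq (s := (Finset.univ : Finset (Fin 4608)))
    (f := fun i => A i - B i)
  rw [Finset.sum_sub_distrib, Finset.card_univ, Fintype.card_fin] at key
  generalize ∑ i : Fin 4608, (A i - B i) ^ 2 = S at key ⊢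
  generalize ∑ i : Fin 4608, A i = a at key ⊢
  generalize ∑ i : Fin 4608, B i = b at key ⊢
  push_cast at key
  linarith
end
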